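/- Let k and n be positive integers with k ≤ (n−3)/2. Then every unbalanced signed complete graph on n vertices contains a negative cycle of length 2k+1. -/

import Mathlib

open scoped Classical

/-- A signed graph: a finite simple graph together with a symmetric sign function
taking value `1` or `-1` on every edge. -/
structure SignedGraph (V : Type*) where
  G : SimpleGraph V
  sign : V → V → ℤ
  sign_symm : ∀ u v, sign u v = sign v u
  sign_pm : ∀ u v, G.Adj u v → sign u v = 1 ∨ sign u v = -1

namespace SignedGraph

variable {V : Type*} {W : Type*}

/-- The sign function on unordered pairs. -/
def edgeSign (SG : SignedGraph V) : Sym2 V → ℤ :=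
  Sym2.lift ⟨SG.sign, SG.sign_symm⟩

/-- The sign of a walk: the product of the signs of its edges. -/
def walkSign (SG : SignedGraph V) {u v : V} (w : SG.G.Walk u v) : ℤ :=
  (w.edges.map SG.edgeSign).prod

/-- `Ġ` contains a negative cycle of length `l`. -/
def HasNegCycleLength (SG : SignedGraph V) (l : ℕ) : Prop :=
  ∃ (v : V) (w : SG.G.Walk v v), w.IsCycle ∧ w.length = l ∧ SG.walkSign w = -1

/-- A signed graph is balanced if it is switching equivalent to the all-positive
signature on the same underlying graph. -/
def Balanced (SG : SignedGraph V) : Prop :=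
  ∃ s : V → ℤ, (∀ x, s x = 1 ∨ s x = -1) ∧
    ∀ u v, SG.G.Adj u v → s u * SG.sign u v * s v = 1

/-- A signed graph is unbalanced if it is not balanced. -/
def Unbalanced (SG : SignedGraph V) : Prop := ¬ SG.Balanced

/-- The number of edges `e(Ġ)` of a signed graph. -/
noncomputable def edgeCount (SG : SignedGraph V) : ℕ := SG.G.edgeSet.ncard

/-- Switching equivalence of signed graphs (up to isomorphism of the underlying
graphs): there is an isomorphism of the underlying graphs under which the two
signatures agree after a switching. -/
def SwitchEquiv (SG : SignedGraph V) (SH : SignedGraph W) : Prop :=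
  ∃ (φ : SG.G ≃g SH.G) (s : V → ℤ), (∀ x, s x = 1 ∨ s x = -1) ∧
    ∀ u v, SG.G.Adj u v → SH.sign (φ u) (φ v) = s u * SG.sign u v * s v

end SignedGraph

namespace SignedGraph

variable {V : Type*}

lemma walkSign_nil (SG : SignedGraph V) (u : V) :
    SG.walkSign (SimpleGraph.Walk.nil : SG.G.Walk u u) = 1 := by
  simp [walkSign]

lemma walkSign_cons (SG : SignedGraph V) {u v w : V} (h : SG.G.Adj u v) (p : SG.G.Walk v w) :
    SG.walkSign (SimpleGraph.Walk.cons h p) = SG.sign u v * SG.walkSign p := by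
  simp [walkSign, edgeSign]

lemma walkSign_eq_one_or_neg_one (SG : SignedGraph V) {u v : V} (p : SG.G.Walk u v) :
    SG.walkSign p = 1 ∨ SG.walkSign p = -1 := by
  induction p with
  | nil => simp [walkSign_nil]
  | cons h p ih =>
    rw [walkSign_cons]
    rcases SG.sign_pm _ _ h with h1 | h1 <;> rcases ih with h2 | h2 <;> simp [h1, h2]

/-- In an antibalanced signed graph the sign of a walk is determined by its ends and the
parity of its length. -/
lemma walkSign_of_antibalanced (SG : SignedGraph V) (s : V → ℤ) (hs : ∀ x, s x * s x = 1)
    (h : ∀ x y, SG.G.Adj x y → SG.sign x y = -(s x * s y)) {u v : V} (p : SG.G.Walk u v) :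
    SG.walkSign p = (-1) ^ p.length * (s u * s v) := by
  induction p with
  | nil => simp [walkSign_nil, hs]
  | @cons a b c hab p ih =>
    rw [walkSign_cons, ih, h _ _ hab, SimpleGraph.Walk.length_cons, pow_succ]
    linear_combination -(-1) ^ p.length * s a * s c * hs b

/-- A complete graph has paths of every feasible length between two vertices, avoiding a
given set. -/
lemma exists_isPath_avoiding [Fintype V] {G : SimpleGraph V} (hG : ∀ u v, u ≠ v → G.Adj u v)
    (m : ℕ) (S : Finset V) (a b : V) (hab : b ≠ a) (ha : a ∉ S) (hb : b ∉ S)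
    (hcard : S.card + m + 2 ≤ Fintype.card V) :
    ∃ p : G.Walk b a, p.IsPath ∧ p.length = m + 1 ∧ ∀ x ∈ S, x ∉ p.support := by
  induction m generalizing S b with
  | zero =>
    refine ⟨SimpleGraph.Walk.cons (hG b a hab) SimpleGraph.Walk.nil, ?_, by simp, ?_⟩
    · simp [SimpleGraph.Walk.cons_isPath_iff, hab]
    · intro x hx
      simp only [SimpleGraph.Walk.support_cons, SimpleGraph.Walk.support_nil, List.mem_cons,
        List.not_mem_nil, or_false]
      rintro (rfl | rfl) <;> contradiction
  | succ m ih =>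
    have hlt : (insert a (insert b S)).card < Fintype.card V := by
      have h1 := Finset.card_insert_le a (insert b S)
      have h2 := Finset.card_insert_le b S
      omega
    obtain ⟨c, hc⟩ := Finset.exists_mem_notMem_of_card_lt_card
      (s := insert a (insert b S)) (t := Finset.univ) (by simpa using hlt)
    simp only [Finset.mem_univ, Finset.mem_insert, not_or, true_and] at hc
    obtain ⟨hca, hcb, hcS⟩ := hc
    obtain ⟨p, hp, hlen, hav⟩ := ih (insert b S) c hca
      (by simp [ha, Ne.symm hab]) (by simp [hcb, hcS])
      (by rw [Finset.card_insert_of_notMem hb]; omega)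
    refine ⟨SimpleGraph.Walk.cons (hG b c (Ne.symm hcb)) p, ?_, by simp [hlen], ?_⟩
    · exact hp.cons (hav b (by simp))
    · intro x hx
      simp only [SimpleGraph.Walk.support_cons, List.mem_cons, not_or]
      exact ⟨fun h => hb (h ▸ hx), hav x (by simp [hx])⟩

lemma isCycle_cons_cons {G : SimpleGraph V} {a x b : V} (hax : G.Adj a x) (hxb : G.Adj x b)
    (hab : a ≠ b) {p : G.Walk b a} (hp : p.IsPath) (hx : x ∉ p.support) :
    (SimpleGraph.Walk.cons hax (SimpleGraph.Walk.cons hxb p)).IsCycle := by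
  rw [SimpleGraph.Walk.cons_isCycle_iff]
  refine ⟨hp.cons hx, ?_⟩
  rw [SimpleGraph.Walk.edges_cons, List.mem_cons, not_or]
  refine ⟨?_, fun h => hx (p.snd_mem_support_of_mem_edges h)⟩
  intro h
  rw [Sym2.eq_iff] at h
  rcases h with ⟨h, -⟩ | ⟨h, -⟩
  · exact hax.ne h
  · exact hab h

/-- If a signed complete graph on at least `m + 4` vertices has no negative cycle of length
`m + 3`, then all its `4`-cycles are positive. -/
lemma sign_mul_sign_eq [Fintype V] (SG : SignedGraph V)
    (hG : ∀ u v, u ≠ v → SG.G.Adj u v) {m : ℕ} (hcard : m + 4 ≤ Fintype.card V)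
    (hneg : ¬ SG.HasNegCycleLength (m + 3)) {a b x y : V} (hab : a ≠ b) (hax : a ≠ x)
    (hay : a ≠ y) (hbx : b ≠ x) (hby : b ≠ y) :
    SG.sign a x * SG.sign x b = SG.sign a y * SG.sign y b := by
  obtain ⟨p, hp, hlen, hav⟩ := exists_isPath_avoiding hG m {x, y} a b hab.symm
    (by simp [hax, hay]) (by simp [hbx, hby])
    (by have := Finset.card_le_two (a := x) (b := y); omega)
  have key : ∀ z, a ≠ z → z ≠ b → z ∉ p.support →
      SG.sign a z * SG.sign z b * SG.walkSign p = 1 := by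
    intro z haz hzb hz
    have hc := isCycle_cons_cons (hG a z haz) (hG z b hzb) hab hp hz
    have hs := SG.walkSign_eq_one_or_neg_one
      (SimpleGraph.Walk.cons (hG a z haz) (SimpleGraph.Walk.cons (hG z b hzb) p))
    rw [mul_assoc, ← walkSign_cons SG (hG z b hzb), ← walkSign_cons SG (hG a z haz)]
    exact hs.resolve_right fun h => hneg ⟨a, _, hc, by simp [hlen], h⟩
  have h1 := key x hax hbx.symm (hav x (by simp))
  have h2 := key y hay hby.symm (hav y (by simp))
  rcases SG.walkSign_eq_one_or_neg_one p with h | h <;> rw [h] at h1 h2 <;> linarith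

/-- An unbalanced signed complete graph has a negative triangle through any vertex. -/
lemma Unbalanced.exists_neg_triangle {SG : SignedGraph V}
    (hG : ∀ u v, u ≠ v → SG.G.Adj u v) (hunb : SG.Unbalanced) (r : V) :
    ∃ u v, u ≠ r ∧ v ≠ r ∧ u ≠ v ∧ SG.sign r u * SG.sign u v * SG.sign r v = -1 := by
  by_contra! hcon
  refine hunb ⟨fun x => if x = r then 1 else SG.sign r x, fun x => ?_, fun u v huv => ?_⟩
  · by_cases hx : x = r
    · simp [hx]
    · simpa [hx] using SG.sign_pm r x (hG r x (Ne.symm hx))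
  · by_cases hu : u = r
    · subst hu
      have hv : v ≠ u := huv.ne'
      rcases SG.sign_pm u v huv with h | h <;> simp [hv, h]
    · by_cases hv : v = r
      · subst hv
        rw [SG.sign_symm]
        rcases SG.sign_pm v u huv.symm with h | h <;> simp [hu, h]
      · have := hcon u v hu hv huv.ne
        rcases SG.sign_pm u v huv with h | h <;>
          rcases SG.sign_pm r u (hG r u (Ne.symm hu)) with h' | h' <;>
          rcases SG.sign_pm r v (hG r v (Ne.symm hv)) with h'' | h'' <;>
          simp_all

end SignedGraph

/-- Every unbalanced signed complete graph on `n` vertices contains a negative cycle of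
length `2k+1`, provided `k ≤ (n-3)/2`. -/
theorem unbalanced_complete_has_neg_odd_cycle {V : Type*} [Fintype V] (n k : ℕ)
    (hk : 1 ≤ k) (hkn : (k : ℝ) ≤ ((n : ℝ) - 3) / 2)
    (SG : SignedGraph V) (hn : Fintype.card V = n)
    (hcomplete : SG.G = ⊤) (hunb : SG.Unbalanced) :
    SG.HasNegCycleLength (2 * k + 1) := by
  have hG : ∀ u v, u ≠ v → SG.G.Adj u v := fun u v h => by rw [hcomplete]; exact h
  have hkn' : 2 * k + 3 ≤ n := by
    have : ((2 * k + 3 : ℕ) : ℝ) ≤ (n : ℝ) := by push_cast; linarith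
    exact_mod_cast this
  obtain ⟨m, rfl⟩ : ∃ m, k = m + 1 := ⟨k - 1, by omega⟩
  by_contra hneg
  have hneg' : ¬ SG.HasNegCycleLength (2 * m + 3) := hneg
  have hcard : 2 * m + 4 ≤ Fintype.card V := by omega
  obtain ⟨r⟩ : Nonempty V := Fintype.card_pos_iff.mp (by omega)
  obtain ⟨u, v, hu, hv, huv, hT⟩ := hunb.exists_neg_triangle hG r
  have hsq : ∀ x y, x ≠ y → SG.sign x y * SG.sign x y = 1 := fun x y h => by
    rcases SG.sign_pm x y (hG x y h) with h | h <;> simp [h]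
  have move : ∀ x y z, x ≠ r → y ≠ r → z ≠ r → x ≠ y → x ≠ z →
      SG.sign r x * SG.sign x y * SG.sign r y = -1 →
      SG.sign r x * SG.sign x z * SG.sign r z = -1 := by
    intro x y z hx hy hz hxy hxz h
    have h4 := SG.sign_mul_sign_eq hG hcard hneg' (Ne.symm hx) (Ne.symm hy) (Ne.symm hz) hxy hxz
    rw [SG.sign_symm y x, SG.sign_symm z x] at h4
    linear_combination h - SG.sign r x * h4
  have symm : ∀ x y, SG.sign r x * SG.sign x y * SG.sign r y = -1 →
      SG.sign r y * SG.sign y x * SG.sign r x = -1 := by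
    intro x y h
    rw [SG.sign_symm y x]
    linear_combination h
  have all : ∀ x y, x ≠ r → y ≠ r → x ≠ y →
      SG.sign r x * SG.sign x y * SG.sign r y = -1 := by
    intro x y hx hy hxy
    by_cases hxu : x = u
    · subst hxu
      exact move x v y hx hv hy huv hxy hT
    · have h1 := move u v x hu hv hx huv (Ne.symm hxu) hT
      exact move x u y hx hu hy hxu hxy (symm u x h1)
  set s : V → ℤ := fun x => if x = r then -1 else SG.sign r x with hs
  have hs1 : ∀ x, s x * s x = 1 := by
    intro x
    by_cases hx : x = r
    · simp [hs, hx]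
    · simpa [hs, hx] using hsq r x (Ne.symm hx)
  have hsign : ∀ x y, SG.G.Adj x y → SG.sign x y = -(s x * s y) := by
    intro x y hxy
    by_cases hx : x = r
    · subst hx
      simp [hs, hxy.ne']
    · by_cases hy : y = r
      · subst hy
        simp [hs, hx, SG.sign_symm x y]
      · simp only [hs, hx, hy, if_false]
        have h1 := hsq r x (Ne.symm hx)
        have h2 := hsq r y (Ne.symm hy)
        have h3 := all x y hx hy hxy.ne
        linear_combination SG.sign r x * SG.sign r y * h3 - SG.sign x y * h1
          - SG.sign x y * SG.sign r x * SG.sign r x * h2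
  obtain ⟨p, hp, hlen, hav⟩ := SignedGraph.exists_isPath_avoiding hG (2 * m) {u} r v hv
    (by simpa using Ne.symm hu) (by simpa using Ne.symm huv) (by simp; omega)
  refine hneg ⟨r, _, SignedGraph.isCycle_cons_cons (hG r u (Ne.symm hu)) (hG u v huv) (Ne.symm hv) hp
    (hav u (by simp)), by simp [hlen]; omega, ?_⟩
  rw [SignedGraph.walkSign_of_antibalanced SG s hs1 hsign, hs1]
  simp only [SimpleGraph.Walk.length_cons, hlen, mul_one]
  exact Odd.neg_one_pow ⟨m + 1, by omega⟩
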